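/- Let (X, π) be an n-partite weighted simplicial complex of rank n, let 0 ≤ ℓ ≤ n, and let H be a k-regular labelled graph on the ℓ-element subsets of [n]. Then the log-Sobolev constants satisfy LS(Papx) ≥ LS(Udw_{ℓ↔n})·Gap*(H), where Papx = UpDown_{ℓ↔n}(X, π, H) is the expanderized up-down walk, Udw_{ℓ↔n} is the usual up-down walk, and Gap*(H) = 1 − λ(H). -/

import Mathlib

open scoped Classical
noncomputable section

namespace Expanderized

/-! ## Generic weighted linear algebra over finite types -/

section Generic

variable {α β γ : Type*}

/-- Inner product `⟨f,g⟩_μ = E_{x∼μ}[f(x)g(x)]` with respect to a weight `μ`. -/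
def inner' [Fintype α] (μ : α → ℝ) (f g : α → ℝ) : ℝ := ∑ x, μ x * (f x * g x)

/-- Expectation with respect to `μ`. -/
def expect [Fintype α] (μ : α → ℝ) (f : α → ℝ) : ℝ := ∑ x, μ x * f x

/-- `μ` is a probability distribution. -/
def IsProbDist [Fintype α] (μ : α → ℝ) : Prop := (∀ x, 0 ≤ μ x) ∧ (∑ x, μ x) = 1

/-- A row-stochastic kernel. -/
def IsRowStochastic [Fintype β] (P : α → β → ℝ) : Prop :=
  (∀ x y, 0 ≤ P x y) ∧ ∀ x, (∑ y, P x y) = 1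

/-- Product of two kernels (matrix multiplication). -/
def matMul [Fintype β] (A : α → β → ℝ) (B : β → γ → ℝ) : α → γ → ℝ :=
  fun x z => ∑ y, A x y * B y z

/-- Right action of a kernel on a function (column vector). -/
def mApp [Fintype β] (A : α → β → ℝ) (f : β → ℝ) : α → ℝ :=
  fun x => ∑ y, A x y * f y

/-- Left action of a kernel on a row vector / measure. -/
def rowMul [Fintype α] (μ : α → ℝ) (A : α → β → ℝ) : β → ℝ :=
  fun y => ∑ x, μ x * A x y

/-- The adjoint of the kernel `P` with respect to the measures `(μ₁, μ₂)`. -/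
def adjointKer [Fintype α] [Fintype β] (μ₁ : α → ℝ) (μ₂ : β → ℝ) (P : α → β → ℝ) :
    β → α → ℝ :=
  fun y x => P x y * μ₁ x / μ₂ y

/-- Iterates of a square kernel. -/
def matIter [Fintype α] [DecidableEq α] (A : α → α → ℝ) : ℕ → (α → α → ℝ)
  | 0 => fun x y => if x = y then 1 else 0
  | (t + 1) => matMul (matIter A t) A

/-- The second-largest eigenvalue `λ₂` of a random walk matrix that is reversible
with respect to `μ`, via its Rayleigh-quotient (Courant–Fischer) characterization. -/
def lambda2 [Fintype α] (μ : α → ℝ) (A : α → α → ℝ) : ℝ :=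
  sSup {r | ∃ f : α → ℝ, inner' μ f f = 1 ∧ inner' μ f (fun _ => 1) = 0 ∧
      r = inner' μ f (mApp A f)}

/-- The spectral gap `1 - λ₂`. -/
def specGap [Fintype α] (μ : α → ℝ) (A : α → α → ℝ) : ℝ := 1 - lambda2 μ A

/-- The two-sided expansion `λ(A) = max(λ₂(A), |λ_min(A)|)` of a random walk matrix
reversible with respect to `μ`, via its Rayleigh-quotient characterization. -/
def twoSided [Fintype α] (μ : α → ℝ) (A : α → α → ℝ) : ℝ :=
  sSup {r | ∃ f : α → ℝ, inner' μ f f = 1 ∧ inner' μ f (fun _ => 1) = 0 ∧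
      r = |inner' μ f (mApp A f)|}

/-- The operator norm `‖A‖_{op,μ}`. -/
def opNorm [Fintype α] (μ : α → ℝ) (A : α → α → ℝ) : ℝ :=
  sSup {r | ∃ f : α → ℝ, inner' μ f f = 1 ∧
      r = Real.sqrt (inner' μ (mApp A f) (mApp A f))}

/-- The `Φ`-entropy functional `Ent^Φ_μ(f) = E_μ[Φ(f)] - Φ(E_μ f)`. -/
def phiEnt [Fintype α] (Φ : ℝ → ℝ) (μ : α → ℝ) (f : α → ℝ) : ℝ :=
  expect μ (fun x => Φ (f x)) - Φ (expect μ f)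

/-- `t ↦ t log t`; note `Real.log 0 = 0`, so the convention `0 log 0 = 0` is built in. -/
def nlog (t : ℝ) : ℝ := t * Real.log t

/-- The usual entropy functional `Ent_μ`. -/
def ent [Fintype α] (μ : α → ℝ) (f : α → ℝ) : ℝ := phiEnt nlog μ f

/-- The `Φ`-entropy contraction constant of a kernel `P` with respect to measures
`(μ₁, μ₂)`: the largest `C ≥ 0` such that `Ent^Φ_{μ₁}(Pf) ≤ (1-C)·Ent^Φ_{μ₂}(f)`
for all nonnegative `f`. -/
def CFphi [Fintype α] [Fintype β] (Φ : ℝ → ℝ) (μ₁ : α → ℝ) (μ₂ : β → ℝ)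
    (P : α → β → ℝ) : ℝ :=
  sSup {C | 0 ≤ C ∧ ∀ f : β → ℝ, (∀ y, 0 ≤ f y) →
      phiEnt Φ μ₁ (mApp P f) ≤ (1 - C) * phiEnt Φ μ₂ f}

/-- The entropy contraction constant `EC(P)`. -/
def EC [Fintype α] [Fintype β] (μ₁ : α → ℝ) (μ₂ : β → ℝ) (P : α → β → ℝ) : ℝ :=
  CFphi nlog μ₁ μ₂ P

/-- The log-Sobolev constant of a reversible kernel `P` with stationary measure `μ`:
the largest `C ≥ 0` with `C·Ent_μ(f²) ≤ ⟨f,(I-P)f⟩_μ` for all nonnegative `f`. -/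
def LS [Fintype α] (μ : α → ℝ) (P : α → α → ℝ) : ℝ :=
  sSup {C | 0 ≤ C ∧ ∀ f : α → ℝ, (∀ x, 0 ≤ f x) →
      C * ent μ (fun x => f x ^ 2) ≤ inner' μ f (fun x => f x - mApp P f x)}

/-- The modified log-Sobolev constant of a reversible kernel `P` with stationary
measure `μ`: the largest `C ≥ 0` with `C·Ent_μ(f) ≤ ⟨f,(I-P) log f⟩_μ`
for all strictly positive `f`. -/
def MLS [Fintype α] (μ : α → ℝ) (P : α → α → ℝ) : ℝ :=
  sSup {C | 0 ≤ C ∧ ∀ f : α → ℝ, (∀ x, 0 < f x) →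
      C * ent μ f ≤
        inner' μ f (fun x => Real.log (f x) - mApp P (fun y => Real.log (f y)) x)}

/-- Total variation distance. -/
def tvDist [Fintype α] (μ ν : α → ℝ) : ℝ := (∑ x, |μ x - ν x|) / 2

/-- The `ε`-mixing time of a kernel `P` towards the target distribution `π`. -/
def mixingTime [Fintype α] [DecidableEq α] (P : α → α → ℝ) (π : α → ℝ) (ε : ℝ) : ℕ :=
  sInf {t : ℕ | ∀ μ₀ : α → ℝ, IsProbDist μ₀ → tvDist (rowMul μ₀ (matIter P t)) π ≤ ε}

end Generic

/-! ## Weighted simplicial complexes -/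

/-- A weighted (pure) simplicial complex of rank `n` on a finite vertex set `V`:
a downward-closed collection of faces, all maximal faces of cardinality `n`,
together with a fully supported probability distribution `pi` on the rank `n` faces
(extended by zero to all finsets). -/
structure WComplex (V : Type*) [Fintype V] [DecidableEq V] (n : ℕ) where
  faces : Finset (Finset V)
  pi : Finset V → ℝ
  faces_nonempty : faces.Nonempty
  down_closed : ∀ α ∈ faces, ∀ β ⊆ α, β ∈ faces
  card_le : ∀ α ∈ faces, α.card ≤ n
  pure : ∀ α ∈ faces, ∃ ω ∈ faces, ω.card = n ∧ α ⊆ ω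
  pi_pos : ∀ ω ∈ faces, ω.card = n → 0 < pi ω
  pi_zero_of_not_mem : ∀ ω : Finset V, ω ∉ faces → pi ω = 0
  pi_zero_of_card_ne : ∀ ω : Finset V, ω.card ≠ n → pi ω = 0
  pi_sum : (∑ ω : Finset V, pi ω) = 1

namespace WComplex

variable {V : Type*} [Fintype V] [DecidableEq V] {n : ℕ}

/-- `Pr_{ω∼π}[ω ⊇ α]` (unnormalized level mass of a face). -/
def mass (K : WComplex V n) (α : Finset V) : ℝ :=
  ∑ ω : Finset V, if α ⊆ ω then K.pi ω else 0

/-- The induced distribution `π_j` on the `j`-th level `X^(j)`. -/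
def level (K : WComplex V n) (j : ℕ) : Finset V → ℝ :=
  fun α => if α.card = j then ((n.choose j : ℝ))⁻¹ * K.mass α else 0

/-- The up-walk `Up_{ℓ→k}`. -/
def up (K : WComplex V n) (ℓ k : ℕ) : Finset V → Finset V → ℝ :=
  fun a b =>
    if a.card = ℓ ∧ b.card = k ∧ a ⊆ b then
      (((n - ℓ).choose (k - ℓ) : ℝ))⁻¹ * (K.mass b / K.mass a)
    else 0

/-- The down-walk `Down_{k→ℓ}`. -/
def down (K : WComplex V n) (k ℓ : ℕ) : Finset V → Finset V → ℝ :=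
  fun a b => if a.card = k ∧ b.card = ℓ ∧ b ⊆ a then ((k.choose ℓ : ℝ))⁻¹ else 0

/-- The down-up walk `Duw_{n↔ℓ} = Down_{n→ℓ}·Up_{ℓ→n}` on `X^(n)`. -/
def downUp (K : WComplex V n) (ℓ : ℕ) : Finset V → Finset V → ℝ :=
  matMul (K.down n ℓ) (K.up ℓ n)

/-- The up-down walk `Udw_{ℓ↔n} = Up_{ℓ→n}·Down_{n→ℓ}` on `X^(ℓ)`. -/
def upDown (K : WComplex V n) (ℓ : ℕ) : Finset V → Finset V → ℝ :=
  matMul (K.up ℓ n) (K.down n ℓ)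

/-- The top-level distribution `π^(ω̂)` of the link complex of the face `z`. -/
def linkPi (K : WComplex V n) (z : Finset V) : Finset V → ℝ :=
  fun α => if Disjoint α z then K.pi (z ∪ α) / K.mass z else 0

/-- Unnormalized level mass in the link of `z`. -/
def linkMass (K : WComplex V n) (z α : Finset V) : ℝ :=
  ∑ β : Finset V, if α ⊆ β then K.linkPi z β else 0

/-- The induced distribution `π^(ω̂)_j` on the `j`-th level of the link of `z`. -/
def linkLevel (K : WComplex V n) (z : Finset V) (j : ℕ) : Finset V → ℝ :=
  fun α => if α.card = j then (((n - z.card).choose j : ℝ))⁻¹ * K.linkMass z α else 0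

/-- The up-walk `Up^{ω̂}_{ℓ→k}` of the link complex of `z`. -/
def linkUp (K : WComplex V n) (z : Finset V) (ℓ k : ℕ) : Finset V → Finset V → ℝ :=
  fun a b =>
    if a.card = ℓ ∧ b.card = k ∧ a ⊆ b then
      ((((n - z.card) - ℓ).choose (k - ℓ) : ℝ))⁻¹ * (K.linkMass z b / K.linkMass z a)
    else 0

/-- The vertex marginal `π^(ω̂)_1` of the link of `z`, as a distribution on vertices. -/
def linkVertex (K : WComplex V n) (z : Finset V) : V → ℝ :=
  fun x => K.linkLevel z 1 {x}

/-- The link random-walk matrix `M_ω̂` of a face `z` (with `|z| ≤ n-2`). -/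
def linkMat (K : WComplex V n) (z : Finset V) : V → V → ℝ :=
  fun x y =>
    if x ≠ y then (K.mass (z ∪ {x, y}) / K.mass (z ∪ {x})) / ((n : ℝ) - z.card - 1)
    else 0

/-- The local `Φ`-entropy contraction constant `lc_Φ(ω̂)`: the smallest `c ≥ 0` with
`Ent^Φ_{π^(ω̂)_1}(Up^{ω̂}_{1→n'} g) ≤ c·Ent^Φ_{π^(ω̂)_{n'}}(g)` for all `g ≥ 0`,
where `n' = n - |ω̂|`. -/
def lcPhi (K : WComplex V n) (Φ : ℝ → ℝ) (z : Finset V) : ℝ :=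
  sInf {c | 0 ≤ c ∧ ∀ g : Finset V → ℝ, (∀ x, 0 ≤ g x) →
      phiEnt Φ (K.linkLevel z 1) (mApp (K.linkUp z 1 (n - z.card)) g)
        ≤ c * phiEnt Φ (K.linkLevel z (n - z.card)) g}

/-- The local entropy contraction constant `lec(ω̂)` (the case `Φ(t) = t log t`). -/
def lec (K : WComplex V n) (z : Finset V) : ℝ := K.lcPhi nlog z

end WComplex

/-! ## Partite complexes, auxiliary expander graphs, and expanderized walks -/

section Partite

variable {n : ℕ} {U : Type*} [Fintype U] [DecidableEq U]

/-- The type of a face of an `n`-partite complex: the set of sides it meets. -/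
def typ (α : Finset (Fin n × U)) : Finset (Fin n) := α.image Prod.fst

/-- The restriction `ω_S` of a face to the sides in `S`. -/
def restrict (ω : Finset (Fin n × U)) (S : Finset (Fin n)) : Finset (Fin n × U) :=
  ω.filter fun v => v.1 ∈ S

/-- An `n`-partite complex: every facet contains exactly one vertex from each side. -/
def IsPartite (K : WComplex (Fin n × U) n) : Prop :=
  ∀ ω ∈ K.faces, ω.card = n → (typ ω).card = n

/-- `H` is a `k`-regular graph all of whose edges join `ℓ`-element subsets of `[n]`. -/
def IsRegularOnSubsets (H : SimpleGraph (Finset (Fin n))) (ℓ k : ℕ) : Prop :=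
  (∀ S T, H.Adj S T → S.card = ℓ ∧ T.card = ℓ) ∧
  (∀ S : Finset (Fin n), S.card = ℓ → (Finset.univ.filter fun T => H.Adj S T).card = k)

/-- The simple random walk matrix of a `k`-regular graph `H`. -/
def walkMat (H : SimpleGraph (Finset (Fin n))) (k : ℕ) :
    Finset (Fin n) → Finset (Fin n) → ℝ :=
  fun S T => if H.Adj S T then (k : ℝ)⁻¹ else 0

/-- The uniform distribution on `ℓ`-element subsets of `[n]`. -/
def unifSubsets (n ℓ : ℕ) : Finset (Fin n) → ℝ :=
  fun S => if S.card = ℓ then ((n.choose ℓ : ℝ))⁻¹ else 0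

/-- The two-sided expansion `λ(H)` of `H`. -/
def lamH (H : SimpleGraph (Finset (Fin n))) (ℓ k : ℕ) : ℝ :=
  twoSided (unifSubsets n ℓ) (walkMat H k)

/-- The two-sided expansion `λ(H²)` of the square of `H` (i.e. of the graph whose
random walk matrix is the square of that of `H`). -/
def lamHsq (H : SimpleGraph (Finset (Fin n))) (ℓ k : ℕ) : ℝ :=
  twoSided (unifSubsets n ℓ) (matMul (walkMat H k) (walkMat H k))

/-- `Pr_{ω∼π}[ω_{typ a} = a ∧ ω_{typ b} = b]`. -/
def jointMass (K : WComplex (Fin n × U) n) (a b : Finset (Fin n × U)) : ℝ :=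
  ∑ ω : Finset (Fin n × U),
    if restrict ω (typ a) = a ∧ restrict ω (typ b) = b then K.pi ω else 0

/-- The expanderized up-down walk with type-transition matrix `W`; taking
`W = walkMat H k` gives `UpDown(X, π, H)`, and taking `W = (walkMat H k)²`
gives `UpDown(X, π, H²)`.  Its `(ω̂, ω̃)` entry is
`W(typ ω̂, typ ω̃) · Pr_{ω∼π}[ω_{typ ω̃} = ω̃ ∣ ω_{typ ω̂} = ω̂]`. -/
def expUpDown (K : WComplex (Fin n × U) n)
    (W : Finset (Fin n) → Finset (Fin n) → ℝ) :
    Finset (Fin n × U) → Finset (Fin n × U) → ℝ :=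
  fun a b => W (typ a) (typ b) * (jointMass K a b / jointMass K a a)

/-- The expanderized down-walk `Qdo` from `X^(n) × binom([n],ℓ)` to `X^(ℓ)`. -/
def Qdown (K : WComplex (Fin n × U) n) (H : SimpleGraph (Finset (Fin n))) (k : ℕ) :
    Finset (Fin n × U) × Finset (Fin n) → Finset (Fin n × U) → ℝ :=
  fun p b => if H.Adj p.2 (typ b) ∧ b ⊆ p.1 then (k : ℝ)⁻¹ else 0

/-- The expanderized up-walk `Qup` from `X^(ℓ)` to `X^(n) × binom([n],ℓ)`
(the adjoint of `Qdown` with respect to `(π_n ⊗ Unif, π_ℓ)`). -/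
def Qup (K : WComplex (Fin n × U) n) (H : SimpleGraph (Finset (Fin n))) (k : ℕ) :
    Finset (Fin n × U) → Finset (Fin n × U) × Finset (Fin n) → ℝ :=
  fun b p =>
    (if H.Adj p.2 (typ b) then (k : ℝ)⁻¹ else 0) *
      ((if b ⊆ p.1 then K.pi p.1 else 0) / K.mass b)

/-- The expanderized down-up walk `Paqx = Qdo·Qup` on `X^(n) × binom([n],ℓ)`. -/
def expDownUp (K : WComplex (Fin n × U) n) (H : SimpleGraph (Finset (Fin n))) (k : ℕ) :
    Finset (Fin n × U) × Finset (Fin n) → Finset (Fin n × U) × Finset (Fin n) → ℝ :=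
  matMul (Qdown K H k) (Qup K H k)

/-- The product distribution `π_n ⊗ Unif_{binom([n],ℓ)}`. -/
def prodDist (K : WComplex (Fin n × U) n) (ℓ : ℕ) :
    Finset (Fin n × U) × Finset (Fin n) → ℝ :=
  fun p => K.pi p.1 * unifSubsets n ℓ p.2

end Partite

/-! ## List colorings -/

section Coloring

variable {n : ℕ} {Col : Type*} [Fintype Col] [DecidableEq Col]

/-- The degree of a vertex in a graph. -/
def degree' {W : Type*} [Fintype W] (G : SimpleGraph W) (v : W) : ℕ :=
  (Finset.univ.filter fun u => G.Adj v u).card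

/-- A proper list coloring of `(G, L)`. -/
def IsProperColoring (G : SimpleGraph (Fin n)) (L : Fin n → Finset Col)
    (c : Fin n → Col) : Prop :=
  (∀ v, c v ∈ L v) ∧ ∀ u v, G.Adj u v → c u ≠ c v

/-- The face `{(v, c v) : v}` associated to a coloring `c`. -/
def colorFace (c : Fin n → Col) : Finset (Fin n × Col) :=
  Finset.univ.image fun v => (v, c v)

/-- `Y` is the list-coloring complex of `(G, L)`: its faces are the subsets of proper
list colorings and its weight is the uniform distribution on proper list colorings. -/
def IsColoringComplex (G : SimpleGraph (Fin n)) (L : Fin n → Finset Col)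
    (Y : WComplex (Fin n × Col) n) : Prop :=
  (∀ α : Finset (Fin n × Col),
      α ∈ Y.faces ↔ ∃ c : Fin n → Col, IsProperColoring G L c ∧ α ⊆ colorFace c) ∧
  (∀ ω : Finset (Fin n × Col),
      Y.pi ω =
        ∑ c : Fin n → Col,
          if IsProperColoring G L c ∧ ω = colorFace c then
            ((Finset.univ.filter fun c' : Fin n → Col =>
                IsProperColoring G L c').card : ℝ)⁻¹
          else 0)

end Coloring

/-! ## Ising models -/

section Ising

variable {n : ℕ}

/-- `±1` value of a Boolean spin. -/
def signR (b : Bool) : ℝ := if b then 1 else -1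

/-- The (unnormalized) Ising weight `exp(½⟨x,Jx⟩ + ⟨h,x⟩)`. -/
def isingWeight (J : Matrix (Fin n) (Fin n) ℝ) (h : Fin n → ℝ) (x : Fin n → Bool) : ℝ :=
  Real.exp ((1 / 2) * (∑ i, ∑ j, J i j * (signR (x i) * signR (x j))) +
    ∑ i, h i * signR (x i))

/-- The face `{(i, x i) : i}` associated to a spin configuration `x`. -/
def spinFace (x : Fin n → Bool) : Finset (Fin n × Bool) :=
  Finset.univ.image fun i => (i, x i)

/-- `Y` is the Ising complex of `(J, h)`. -/
def IsIsingComplex (J : Matrix (Fin n) (Fin n) ℝ) (h : Fin n → ℝ)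
    (Y : WComplex (Fin n × Bool) n) : Prop :=
  (∀ α : Finset (Fin n × Bool), α ∈ Y.faces ↔ ∃ x : Fin n → Bool, α ⊆ spinFace x) ∧
  (∀ ω : Finset (Fin n × Bool),
      Y.pi ω =
        (∑ x : Fin n → Bool, if ω = spinFace x then isingWeight J h x else 0) /
          ∑ x : Fin n → Bool, isingWeight J h x)

/-- The `ℓ₂ → ℓ₂` operator norm of a square matrix. -/
def matOpNorm {m : ℕ} (J : Matrix (Fin m) (Fin m) ℝ) : ℝ :=
  sSup {r | ∃ v : Fin m → ℝ, (∑ i, v i ^ 2) = 1 ∧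
      r = Real.sqrt (∑ i, (J.mulVec v i) ^ 2)}

/-- The `2×2` principal submatrix of `J` at rows/columns `i, j`. -/
def principal2 (J : Matrix (Fin n) (Fin n) ℝ) (i j : Fin n) : Matrix (Fin 2) (Fin 2) ℝ :=
  !![J i i, J i j; J j i, J j j]

/-- `‖h‖_∞`. -/
def normInf (h : Fin n → ℝ) : ℝ := sSup (Set.range fun i => |h i|)

/-- `‖h‖_₁`. -/
def norm1 (h : Fin n → ℝ) : ℝ := ∑ i, |h i|

end Ising

end Expanderized

namespace Expanderized

section Generic

variable {α : Type*} [Fintype α]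

lemma inner'_sub_mApp (μ : α → ℝ) (P : α → α → ℝ) (f : α → ℝ) :
    inner' μ f (fun x => f x - mApp P f x) = inner' μ f f - inner' μ f (mApp P f) := by
  simp only [inner', ← Finset.sum_sub_distrib]
  exact Finset.sum_congr rfl fun x _ => by ring

/-- A lower bound on the Dirichlet form of `P` by a multiple of that of `Q` yields the same
comparison of the log-Sobolev constants. -/
lemma LS_mul_le_LS (μ : α → ℝ) (P Q : α → α → ℝ) (g : ℝ)
    (h : ∀ f : α → ℝ, g * inner' μ f (fun x => f x - mApp Q f x) ≤
      inner' μ f (fun x => f x - mApp P f x)) :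
    LS μ Q * g ≤ LS μ P := by
  have nonneg : ∀ R : α → α → ℝ, 0 ≤ LS μ R := fun R =>
    Real.sSup_nonneg fun C hC => hC.1
  rcases le_or_gt g 0 with hg | hg
  · exact (mul_nonpos_of_nonneg_of_nonpos (nonneg Q) hg).trans (nonneg P)
  by_cases hb : BddAbove {C | 0 ≤ C ∧ ∀ f : α → ℝ, (∀ x, 0 ≤ f x) →
      C * ent μ (fun x => f x ^ 2) ≤ inner' μ f (fun x => f x - mApp P f x)}
  · rw [← le_div_iff₀ hg]
    refine Real.sSup_le (fun C hC => ?_) (div_nonneg (nonneg P) hg.le)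
    rw [le_div_iff₀ hg]
    refine le_csSup hb ⟨mul_nonneg hC.1 hg.le, fun f hf => ?_⟩
    calc C * g * ent μ (fun x => f x ^ 2) = g * (C * ent μ (fun x => f x ^ 2)) := by ring
      _ ≤ g * inner' μ f (fun x => f x - mApp Q f x) :=
        mul_le_mul_of_nonneg_left (hC.2 f hf) hg.le
      _ ≤ _ := h f
  · have hent : ∀ f : α → ℝ, (∀ x, 0 ≤ f x) → ent μ (fun x => f x ^ 2) ≤ 0 := by
      intro f hf
      by_contra! hpos
      refine hb ⟨inner' μ f (fun x => f x - mApp P f x) / ent μ (fun x => f x ^ 2),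
        fun C hC => ?_⟩
      rw [le_div_iff₀ hpos]
      exact hC.2 f hf
    have hQ : LS μ Q = 0 := by
      unfold LS
      rcases Set.eq_empty_or_nonempty {C | 0 ≤ C ∧ ∀ f : α → ℝ, (∀ x, 0 ≤ f x) →
        C * ent μ (fun x => f x ^ 2) ≤ inner' μ f (fun x => f x - mApp Q f x)} with he | ⟨C, hC⟩
      · rw [he, Real.sSup_empty]
      · refine Real.sSup_of_not_bddAbove ?_
        rintro ⟨B, hB⟩
        have hle : C ≤ max C B + 1 := (le_max_left C B).trans (by linarith)
        have := hB (a := max C B + 1) ⟨hC.1.trans hle, fun f hf =>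
          (mul_le_mul_of_nonpos_right hle (hent f hf)).trans (hC.2 f hf)⟩
        linarith [le_max_right C B]
    rw [hQ, zero_mul]
    exact nonneg P

/-- A kernel that is self-adjoint and stochastic in the weighted sense is a contraction in
quadratic form. -/
lemma abs_inner'_mApp_le (μ : α → ℝ) (A : α → α → ℝ) (hμA : ∀ x y, 0 ≤ μ x * A x y)
    (hsymm : ∀ x y, μ x * A x y = μ y * A y x) (hrow : ∀ x, ∑ y, μ x * A x y = μ x)
    (f : α → ℝ) : |inner' μ f (mApp A f)| ≤ inner' μ f f := by
  have hexp : inner' μ f (mApp A f) = ∑ x, ∑ y, μ x * A x y * (f x * f y) := by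
    simp only [inner', mApp, Finset.mul_sum]
    exact Finset.sum_congr rfl fun x _ => Finset.sum_congr rfl fun y _ => by ring
  have h1 : ∑ x, ∑ y, μ x * A x y * (f x * f x) = inner' μ f f := by
    simp only [← Finset.sum_mul, hrow, inner']
  have h2 : ∑ x, ∑ y, μ x * A x y * (f y * f y) = inner' μ f f := by
    rw [Finset.sum_comm, ← h1]
    exact Finset.sum_congr rfl fun x _ => Finset.sum_congr rfl fun y _ => by rw [hsymm]
  have h3 : inner' μ f f =
      ∑ x, ∑ y, μ x * A x y * ((f x * f x + f y * f y) / 2) := by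
    have : ∑ x, ∑ y, μ x * A x y * ((f x * f x + f y * f y) / 2) =
        (∑ x, ∑ y, μ x * A x y * (f x * f x) + ∑ x, ∑ y, μ x * A x y * (f y * f y)) / 2 := by
      simp only [← Finset.sum_add_distrib, Finset.sum_div]
      exact Finset.sum_congr rfl fun x _ => Finset.sum_congr rfl fun y _ => by ring
    rw [this, h1, h2]
    ring
  rw [hexp, h3]
  refine (Finset.abs_sum_le_sum_abs _ _).trans (Finset.sum_le_sum fun x _ => ?_)
  refine (Finset.abs_sum_le_sum_abs _ _).trans (Finset.sum_le_sum fun y _ => ?_)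
  rw [abs_mul, abs_of_nonneg (hμA x y)]
  refine mul_le_mul_of_nonneg_left ?_ (hμA x y)
  rw [abs_le]
  constructor <;> nlinarith [sq_nonneg (f x - f y), sq_nonneg (f x + f y)]

lemma inner'_mApp_le_twoSided_mul (μ : α → ℝ) (A : α → α → ℝ) (hμ : ∀ x, 0 ≤ μ x)
    (hμA : ∀ x y, 0 ≤ μ x * A x y) (hsymm : ∀ x y, μ x * A x y = μ y * A y x)
    (hrow : ∀ x, ∑ y, μ x * A x y = μ x) (f : α → ℝ) (hf : inner' μ f (fun _ => 1) = 0) :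
    inner' μ f (mApp A f) ≤ twoSided μ A * inner' μ f f := by
  have hnn : 0 ≤ inner' μ f f :=
    Finset.sum_nonneg fun x _ => mul_nonneg (hμ x) (mul_self_nonneg _)
  rcases hnn.eq_or_lt with h0 | hpos
  · have := abs_inner'_mApp_le μ A hμA hsymm hrow f
    rw [← h0] at this ⊢
    rw [mul_zero]
    exact (le_abs_self _).trans this
  set c := (Real.sqrt (inner' μ f f))⁻¹ with hc
  have hcc : c * c * inner' μ f f = 1 := by
    rw [hc, ← mul_inv, Real.mul_self_sqrt hnn, inv_mul_cancel₀ hpos.ne']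
  have hscale : inner' μ (fun x => c * f x) (fun x => c * f x) = c * c * inner' μ f f := by
    simp only [inner', Finset.mul_sum]
    exact Finset.sum_congr rfl fun x _ => by ring
  have hscaleA : inner' μ (fun x => c * f x) (mApp A fun x => c * f x) =
      c * c * inner' μ f (mApp A f) := by
    simp only [inner', mApp, Finset.mul_sum]
    exact Finset.sum_congr rfl fun x _ => Finset.sum_congr rfl fun y _ => by ring
  have hscale1 : inner' μ (fun x => c * f x) (fun _ => 1) = 0 := by
    have : inner' μ (fun x => c * f x) (fun _ => 1) = c * inner' μ f (fun _ => 1) := by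
      simp only [inner', Finset.mul_sum]
      exact Finset.sum_congr rfl fun x _ => by ring
    rw [this, hf, mul_zero]
  have hle : |c * c * inner' μ f (mApp A f)| ≤ twoSided μ A := by
    refine le_csSup ⟨1, ?_⟩ ⟨fun x => c * f x, hscale.trans hcc, hscale1, by rw [hscaleA]⟩
    rintro r ⟨g, hg, -, rfl⟩
    exact hg ▸ abs_inner'_mApp_le μ A hμA hsymm hrow g
  calc inner' μ f (mApp A f) = (c * c * inner' μ f (mApp A f)) * inner' μ f f := by
        linear_combination -(inner' μ f (mApp A f)) * hcc
    _ ≤ twoSided μ A * inner' μ f f :=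
        mul_le_mul_of_nonneg_right ((le_abs_self _).trans hle) hnn

/-- The Dirichlet form of `A` is at least `1 - λ(A)` times the variance. -/
lemma gap_mul_variance_le (μ : α → ℝ) (A : α → α → ℝ) (hμ : IsProbDist μ)
    (hμA : ∀ x y, 0 ≤ μ x * A x y) (hsymm : ∀ x y, μ x * A x y = μ y * A y x)
    (hrow : ∀ x, ∑ y, μ x * A x y = μ x) (f : α → ℝ) :
    (1 - twoSided μ A) * (inner' μ f f - expect μ f * expect μ f) ≤
      inner' μ f f - inner' μ f (mApp A f) := by
  set m := expect μ f with hm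
  have hcol : ∑ x, ∑ y, μ x * A x y * f y = m := by
    rw [Finset.sum_comm]
    simp only [hsymm, ← Finset.sum_mul, hrow]
    rfl
  have hrow' : ∑ x, ∑ y, μ x * A x y * f x = m := by
    simp only [← Finset.sum_mul, hrow]
    rfl
  have h1 : inner' μ (fun x => f x - m) (fun _ => 1) = 0 := by
    have : inner' μ (fun x => f x - m) (fun _ => 1) = expect μ f - m * ∑ x, μ x := by
      simp only [inner', expect, Finset.mul_sum, ← Finset.sum_sub_distrib]
      exact Finset.sum_congr rfl fun x _ => by ring
    rw [this, hμ.2, ← hm]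
    ring
  have h2 : inner' μ (fun x => f x - m) (fun x => f x - m) = inner' μ f f - m * m := by
    have : inner' μ (fun x => f x - m) (fun x => f x - m) =
        inner' μ f f - 2 * m * expect μ f + m * m * ∑ x, μ x := by
      simp only [inner', expect, Finset.mul_sum, ← Finset.sum_sub_distrib,
        ← Finset.sum_add_distrib]
      exact Finset.sum_congr rfl fun x _ => by ring
    rw [this, hμ.2, ← hm]
    ring
  have h3 : inner' μ (fun x => f x - m) (mApp A fun x => f x - m) =
      inner' μ f (mApp A f) - m * m := by
    have : inner' μ (fun x => f x - m) (mApp A fun x => f x - m) =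
        inner' μ f (mApp A f) - m * (∑ x, ∑ y, μ x * A x y * f x)
          - m * (∑ x, ∑ y, μ x * A x y * f y) + m * m * (∑ x, ∑ y, μ x * A x y) := by
      simp only [inner', mApp, Finset.mul_sum, ← Finset.sum_sub_distrib,
        ← Finset.sum_add_distrib]
      exact Finset.sum_congr rfl fun x _ => Finset.sum_congr rfl fun y _ => by ring
    rw [this, hcol, hrow']
    simp only [hrow, hμ.2]
    ring
  have := inner'_mApp_le_twoSided_mul μ A hμ.1 hμA hsymm hrow _ h1
  rw [h2, h3] at this
  linarith

end Generic

section Subsets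

variable {n ℓ k : ℕ}

lemma isProbDist_unifSubsets (hℓ : ℓ ≤ n) : IsProbDist (unifSubsets n ℓ) := by
  constructor
  · intro S
    unfold unifSubsets
    split_ifs <;> positivity
  · have hpos : (0 : ℝ) < n.choose ℓ := by exact_mod_cast Nat.choose_pos hℓ
    have hcard : (Finset.univ.filter fun S : Finset (Fin n) => S.card = ℓ).card =
        n.choose ℓ := by
      have := Finset.card_powersetCard ℓ (Finset.univ : Finset (Fin n))
      rw [Finset.card_univ, Fintype.card_fin] at this
      rw [← this]
      congr 1
      ext S
      simp [Finset.mem_powersetCard]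
    simp only [unifSubsets]
    rw [← Finset.sum_filter, Finset.sum_const, hcard, nsmul_eq_mul, mul_inv_cancel₀ hpos.ne']

lemma unifSubsets_mul_walkMat_nonneg (H : SimpleGraph (Finset (Fin n))) (S T : Finset (Fin n)) :
    0 ≤ unifSubsets n ℓ S * walkMat H k S T := by
  unfold unifSubsets walkMat
  split_ifs <;> positivity

lemma unifSubsets_mul_walkMat_symm {H : SimpleGraph (Finset (Fin n))}
    (hreg : IsRegularOnSubsets H ℓ k) (S T : Finset (Fin n)) :
    unifSubsets n ℓ S * walkMat H k S T = unifSubsets n ℓ T * walkMat H k T S := by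
  unfold unifSubsets walkMat
  by_cases h : H.Adj S T
  · simp [h, h.symm, hreg.1 S T h]
  · have h' : ¬H.Adj T S := fun h' => h h'.symm
    simp [h, h']

lemma sum_unifSubsets_mul_walkMat {H : SimpleGraph (Finset (Fin n))}
    (hreg : IsRegularOnSubsets H ℓ k) (hk : 0 < k) (S : Finset (Fin n)) :
    ∑ T, unifSubsets n ℓ S * walkMat H k S T = unifSubsets n ℓ S := by
  rw [← Finset.mul_sum]
  by_cases h : S.card = ℓ
  · have : ∑ T, walkMat H k S T = 1 := by
      have hk' : (k : ℝ) ≠ 0 := by exact_mod_cast hk.ne'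
      simp only [walkMat]
      rw [← Finset.sum_filter, Finset.sum_const, hreg.2 S h, nsmul_eq_mul, mul_inv_cancel₀ hk']
    rw [this, mul_one]
  · simp [unifSubsets, h]

end Subsets

section Transversal

variable {n ℓ : ℕ} {U : Type*}

lemma restrict_typ_eq_iff {ω : Finset (Fin n × U)} (hinj : Set.InjOn Prod.fst (ω : Set (Fin n × U)))
    (a : Finset (Fin n × U)) : restrict ω (typ a) = a ↔ a ⊆ ω := by
  constructor
  · intro h
    rw [← h]
    exact Finset.filter_subset _ _
  · intro h
    ext v
    simp only [restrict, typ, Finset.mem_filter, Finset.mem_image]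
    constructor
    · rintro ⟨hv, w, hw, hwv⟩
      rwa [← hinj (h hw) hv hwv]
    · exact fun hv => ⟨h hv, v, hv, rfl⟩

lemma typ_restrict {ω : Finset (Fin n × U)} (htyp : typ ω = Finset.univ) (S : Finset (Fin n)) :
    typ (restrict ω S) = S := by
  ext i
  simp only [restrict, typ, Finset.mem_filter, Finset.mem_image]
  constructor
  · rintro ⟨v, ⟨-, hv⟩, rfl⟩
    exact hv
  · intro hi
    have : i ∈ typ ω := htyp ▸ Finset.mem_univ i
    obtain ⟨v, hv, rfl⟩ := Finset.mem_image.1 this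
    exact ⟨v, ⟨hv, hi⟩, rfl⟩

lemma card_restrict {ω : Finset (Fin n × U)} (hinj : Set.InjOn Prod.fst (ω : Set (Fin n × U)))
    (htyp : typ ω = Finset.univ) (S : Finset (Fin n)) : (restrict ω S).card = S.card := by
  have h : (typ (restrict ω S)).card = (restrict ω S).card :=
    Finset.card_image_of_injOn (hinj.mono (Finset.coe_subset.2 (Finset.filter_subset _ _)))
  rw [← h, typ_restrict htyp]

variable [Fintype U] [DecidableEq U]

/-- The faces below a transversal `ω` are exactly its restrictions `ω_S`. -/
lemma sum_subset_eq_sum_restrict {ω : Finset (Fin n × U)}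
    (hinj : Set.InjOn Prod.fst (ω : Set (Fin n × U))) (htyp : typ ω = Finset.univ)
    (F : Finset (Fin n × U) → ℝ) :
    ∑ a, (if a ⊆ ω then F a else 0) = ∑ S, F (restrict ω S) := by
  rw [← Finset.sum_filter]
  refine Finset.sum_bij' (fun a _ => typ a) (fun S _ => restrict ω S) (fun _ _ => Finset.mem_univ _)
    (fun S _ => ?_) (fun a ha => ?_) (fun S _ => typ_restrict htyp S) (fun a ha => ?_)
  · exact Finset.mem_filter.2 ⟨Finset.mem_univ _, Finset.filter_subset _ _⟩
  · exact (restrict_typ_eq_iff hinj a).2 (Finset.mem_filter.1 ha).2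
  · rw [(restrict_typ_eq_iff hinj a).2 (Finset.mem_filter.1 ha).2]

lemma sum_subset_card_eq {ω : Finset (Fin n × U)}
    (hinj : Set.InjOn Prod.fst (ω : Set (Fin n × U))) (htyp : typ ω = Finset.univ)
    (F : Finset (Fin n × U) → ℝ) :
    ∑ a, (if a ⊆ ω then (if a.card = ℓ then ((n.choose ℓ : ℝ))⁻¹ else 0) * F a else 0) =
      expect (unifSubsets n ℓ) (fun S => F (restrict ω S)) := by
  rw [sum_subset_eq_sum_restrict hinj htyp]
  simp only [expect, unifSubsets, card_restrict hinj htyp]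

end Transversal

namespace WComplex

variable {V : Type*} [Fintype V] [DecidableEq V] {n : ℕ} (K : WComplex V n)

lemma pi_nonneg (ω : Finset V) : 0 ≤ K.pi ω := by
  by_cases h : ω ∈ K.faces
  · by_cases hc : ω.card = n
    · exact (K.pi_pos ω h hc).le
    · exact (K.pi_zero_of_card_ne ω hc).ge
  · exact (K.pi_zero_of_not_mem ω h).ge

lemma card_of_pi_ne_zero {ω : Finset V} (h : K.pi ω ≠ 0) : ω.card = n :=
  not_imp_comm.1 (K.pi_zero_of_card_ne ω) h

lemma mass_mul_div_mass {a ω : Finset V} (h : a ⊆ ω) : K.mass a * (K.pi ω / K.mass a) = K.pi ω := by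
  by_cases hm : K.mass a = 0
  · have hω := (Finset.sum_eq_zero_iff_of_nonneg (fun ω _ => by
      split_ifs
      · exact K.pi_nonneg ω
      · exact le_rfl)).1 hm ω (Finset.mem_univ ω)
    rw [if_pos h] at hω
    rw [hω, zero_div, mul_zero]
  · exact mul_div_cancel₀ _ hm

lemma mass_of_card_eq {ω : Finset V} (h : ω.card = n) : K.mass ω = K.pi ω := by
  unfold mass
  rw [Finset.sum_eq_single ω]
  · simp
  · intro τ _ hne
    split_ifs with hsub
    · refine K.pi_zero_of_card_ne τ fun hτ => hne ?_
      exact (Finset.eq_of_subset_of_card_le hsub (by omega)).symm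
    · rfl
  · simp

lemma level_mul_up (ℓ : ℕ) (a ω : Finset V) :
    K.level ℓ a * K.up ℓ n a ω =
      K.pi ω * (if a ⊆ ω then (if a.card = ℓ then ((n.choose ℓ : ℝ))⁻¹ else 0) else 0) := by
  by_cases hω : ω.card = n
  · by_cases ha : a.card = ℓ
    · by_cases hs : a ⊆ ω
      · simp only [level, up, ha, hω, hs, and_self, if_true, Nat.choose_self, Nat.cast_one,
          inv_one, one_mul, K.mass_of_card_eq hω]
        rw [mul_assoc, K.mass_mul_div_mass hs, mul_comm]
      · simp [up, hs]
    · simp [level, ha]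
  · simp [up, hω, K.pi_zero_of_card_ne ω hω]

lemma pi_mul_down (ℓ : ℕ) (ω b : Finset V) :
    K.pi ω * K.down n ℓ ω b =
      K.pi ω * (if b ⊆ ω then (if b.card = ℓ then ((n.choose ℓ : ℝ))⁻¹ else 0) else 0) := by
  by_cases hω : ω.card = n
  · by_cases hb : b.card = ℓ <;> simp [down, hω, hb]
  · simp [K.pi_zero_of_card_ne ω hω]

end WComplex

section Partite

variable {n ℓ k : ℕ} {U : Type*} [Fintype U] [DecidableEq U] {K : WComplex (Fin n × U) n}

lemma card_typ_of_pi_ne_zero (hpart : IsPartite K) {ω : Finset (Fin n × U)} (h : K.pi ω ≠ 0) :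
    (typ ω).card = n :=
  hpart ω (not_imp_comm.1 (K.pi_zero_of_not_mem ω) h) (K.card_of_pi_ne_zero h)

lemma injOn_fst_of_pi_ne_zero (hpart : IsPartite K) {ω : Finset (Fin n × U)} (h : K.pi ω ≠ 0) :
    Set.InjOn Prod.fst (ω : Set (Fin n × U)) := by
  refine Finset.injOn_of_card_image_eq ?_
  exact (card_typ_of_pi_ne_zero hpart h).trans (K.card_of_pi_ne_zero h).symm

lemma typ_eq_univ_of_pi_ne_zero (hpart : IsPartite K) {ω : Finset (Fin n × U)}
    (h : K.pi ω ≠ 0) : typ ω = Finset.univ := by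
  rw [← Finset.card_eq_iff_eq_univ, card_typ_of_pi_ne_zero hpart h, Fintype.card_fin]

lemma jointMass_eq (hpart : IsPartite K) (a b : Finset (Fin n × U)) :
    jointMass K a b = ∑ ω, if a ⊆ ω ∧ b ⊆ ω then K.pi ω else 0 := by
  refine Finset.sum_congr rfl fun ω _ => ?_
  by_cases h : K.pi ω = 0
  · simp [h]
  · have hinj := injOn_fst_of_pi_ne_zero hpart h
    simp only [restrict_typ_eq_iff hinj]

lemma jointMass_self (hpart : IsPartite K) (a : Finset (Fin n × U)) :
    jointMass K a a = K.mass a := by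
  simp only [jointMass_eq hpart, and_self, WComplex.mass]

lemma inner'_level (hpart : IsPartite K) (f g : Finset (Fin n × U) → ℝ) :
    inner' (K.level ℓ) f g = ∑ ω, K.pi ω *
      inner' (unifSubsets n ℓ) (fun S => f (restrict ω S)) (fun S => g (restrict ω S)) := by
  have hL : inner' (K.level ℓ) f g = ∑ ω, K.pi ω * ∑ a, if a ⊆ ω then
      (if a.card = ℓ then ((n.choose ℓ : ℝ))⁻¹ else 0) * (f a * g a) else 0 := by
    simp only [inner', WComplex.level, WComplex.mass, Finset.mul_sum]
    rw [Finset.sum_comm]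
    refine Finset.sum_congr rfl fun a _ => ?_
    split_ifs with h
    · rw [Finset.sum_mul]
      refine Finset.sum_congr rfl fun ω _ => ?_
      split_ifs <;> ring
    · simp
  rw [hL]
  refine Finset.sum_congr rfl fun ω _ => ?_
  by_cases h : K.pi ω = 0
  · simp [h]
  have hinj := injOn_fst_of_pi_ne_zero hpart h
  have htyp := typ_eq_univ_of_pi_ne_zero hpart h
  rw [sum_subset_card_eq hinj htyp]
  rfl

lemma inner'_level_mApp_upDown (hpart : IsPartite K) (f : Finset (Fin n × U) → ℝ) :
    inner' (K.level ℓ) f (mApp (K.upDown ℓ) f) = ∑ ω, K.pi ω *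
      (expect (unifSubsets n ℓ) (fun S => f (restrict ω S)) *
        expect (unifSubsets n ℓ) (fun S => f (restrict ω S))) := by
  have hL : inner' (K.level ℓ) f (mApp (K.upDown ℓ) f) = ∑ a, ∑ b, ∑ ω,
      K.level ℓ a * K.up ℓ n a ω * K.down n ℓ ω b * (f a * f b) := by
    simp only [inner', mApp, WComplex.upDown, matMul, Finset.mul_sum, Finset.sum_mul]
    exact Finset.sum_congr rfl fun a _ => Finset.sum_congr rfl fun b _ =>
      Finset.sum_congr rfl fun ω _ => by ring
  have hswap : inner' (K.level ℓ) f (mApp (K.upDown ℓ) f) = ∑ ω, ∑ a, ∑ b,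
      K.level ℓ a * K.up ℓ n a ω * K.down n ℓ ω b * (f a * f b) :=
    hL.trans ((Finset.sum_congr rfl fun a _ => Finset.sum_comm).trans Finset.sum_comm)
  rw [hswap]
  refine Finset.sum_congr rfl fun ω _ => ?_
  have hterm : ∀ a b, K.level ℓ a * K.up ℓ n a ω * K.down n ℓ ω b * (f a * f b) = K.pi ω *
      ((if a ⊆ ω then (if a.card = ℓ then ((n.choose ℓ : ℝ))⁻¹ else 0) * f a else 0) *
        (if b ⊆ ω then (if b.card = ℓ then ((n.choose ℓ : ℝ))⁻¹ else 0) * f b else 0)) := by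
    intro a b
    rw [K.level_mul_up, mul_right_comm (K.pi ω), K.pi_mul_down]
    simp only [← ite_zero_mul]
    ring
  simp only [hterm, ← Finset.mul_sum]
  rw [← Finset.sum_mul]
  by_cases h : K.pi ω = 0
  · simp [h]
  rw [sum_subset_card_eq (injOn_fst_of_pi_ne_zero hpart h) (typ_eq_univ_of_pi_ne_zero hpart h)]

lemma inner'_level_mApp_expUpDown (hpart : IsPartite K) (W : Finset (Fin n) → Finset (Fin n) → ℝ)
    (f : Finset (Fin n × U) → ℝ) :
    inner' (K.level ℓ) f (mApp (expUpDown K W) f) = ∑ ω, K.pi ω *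
      inner' (unifSubsets n ℓ) (fun S => f (restrict ω S))
        (mApp W fun S => f (restrict ω S)) := by
  have hterm : ∀ a b, K.level ℓ a * (f a * (expUpDown K W a b * f b)) = ∑ ω, K.pi ω *
      (if a ⊆ ω then (if a.card = ℓ then ((n.choose ℓ : ℝ))⁻¹ else 0) *
        (f a * (if b ⊆ ω then W (typ a) (typ b) * f b else 0)) else 0) := by
    intro a b
    by_cases ha : a.card = ℓ
    · simp only [WComplex.level, expUpDown, ha, if_true, jointMass_self hpart,
        jointMass_eq hpart a b, Finset.sum_div, Finset.mul_sum, Finset.sum_mul]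
      refine Finset.sum_congr rfl fun ω _ => ?_
      by_cases hs : a ⊆ ω
      · by_cases hb : b ⊆ ω
        · simp only [hs, hb, and_self, if_true]
          linear_combination ((n.choose ℓ : ℝ))⁻¹ * f a * W (typ a) (typ b) * f b *
            K.mass_mul_div_mass hs
        · simp [hb]
      · simp [hs]
    · simp [WComplex.level, ha]
  have hL : inner' (K.level ℓ) f (mApp (expUpDown K W) f) = ∑ a, ∑ b, ∑ ω, K.pi ω *
      (if a ⊆ ω then (if a.card = ℓ then ((n.choose ℓ : ℝ))⁻¹ else 0) *
        (f a * (if b ⊆ ω then W (typ a) (typ b) * f b else 0)) else 0) := by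
    simp only [← hterm, inner', mApp, Finset.mul_sum]
  have hswap : inner' (K.level ℓ) f (mApp (expUpDown K W) f) = ∑ ω, ∑ a, ∑ b, K.pi ω *
      (if a ⊆ ω then (if a.card = ℓ then ((n.choose ℓ : ℝ))⁻¹ else 0) *
        (f a * (if b ⊆ ω then W (typ a) (typ b) * f b else 0)) else 0) :=
    hL.trans ((Finset.sum_congr rfl fun a _ => Finset.sum_comm).trans Finset.sum_comm)
  rw [hswap]
  refine Finset.sum_congr rfl fun ω _ => ?_
  by_cases h : K.pi ω = 0
  · simp [h]
  have hinj := injOn_fst_of_pi_ne_zero hpart h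
  have htyp := typ_eq_univ_of_pi_ne_zero hpart h
  have hinner : ∀ a, (∑ b, K.pi ω *
      (if a ⊆ ω then (if a.card = ℓ then ((n.choose ℓ : ℝ))⁻¹ else 0) *
        (f a * (if b ⊆ ω then W (typ a) (typ b) * f b else 0)) else 0)) = K.pi ω *
      (if a ⊆ ω then (if a.card = ℓ then ((n.choose ℓ : ℝ))⁻¹ else 0) *
        (f a * ∑ T, W (typ a) T * f (restrict ω T)) else 0) := by
    intro a
    have := sum_subset_eq_sum_restrict hinj htyp fun b => W (typ a) (typ b) * f b
    simp only [typ_restrict htyp] at this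
    rw [← Finset.mul_sum, ← this]
    split_ifs <;> simp [Finset.mul_sum]
  simp only [hinner, ← Finset.mul_sum]
  rw [sum_subset_card_eq hinj htyp]
  simp only [typ_restrict htyp]
  rfl

lemma gap_mul_upDown_le_expUpDown (hpart : IsPartite K) (hℓ : ℓ ≤ n)
    {H : SimpleGraph (Finset (Fin n))} (hreg : IsRegularOnSubsets H ℓ k) (hk : 0 < k)
    (f : Finset (Fin n × U) → ℝ) :
    (1 - lamH H ℓ k) * inner' (K.level ℓ) f (fun x => f x - mApp (K.upDown ℓ) f x) ≤
      inner' (K.level ℓ) f (fun x => f x - mApp (expUpDown K (walkMat H k)) f x) := by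
  rw [inner'_sub_mApp, inner'_sub_mApp, inner'_level_mApp_upDown hpart,
    inner'_level_mApp_expUpDown hpart, inner'_level hpart, ← Finset.sum_sub_distrib,
    ← Finset.sum_sub_distrib, Finset.mul_sum]
  refine Finset.sum_le_sum fun ω _ => ?_
  rw [← mul_sub, ← mul_sub, mul_left_comm]
  exact mul_le_mul_of_nonneg_left
    (gap_mul_variance_le _ _ (isProbDist_unifSubsets hℓ) (unifSubsets_mul_walkMat_nonneg H)
      (unifSubsets_mul_walkMat_symm hreg) (sum_unifSubsets_mul_walkMat hreg hk) _)
    (K.pi_nonneg ω)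

end Partite

end Expanderized

open Expanderized WComplex in
/-- The log-Sobolev constants satisfy
`LS(Papx) ≥ LS(Udw_{ℓ↔n})·Gap*(H)` for the expanderized up-down walk
`Papx = UpDown_{ℓ↔n}(X, π, H)`. -/
theorem statement2 {n ℓ k : ℕ} {U : Type*} [Fintype U] [DecidableEq U]
    (K : WComplex (Fin n × U) n) (hpart : IsPartite K) (hℓ : ℓ ≤ n)
    (H : SimpleGraph (Finset (Fin n))) (hreg : IsRegularOnSubsets H ℓ k) (hk : 0 < k) :
    LS (K.level ℓ) (K.upDown ℓ) * (1 - lamH H ℓ k) ≤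
      LS (K.level ℓ) (expUpDown K (walkMat H k)) := by
  exact LS_mul_le_LS _ _ _ _ (gap_mul_upDown_le_expUpDown hpart hℓ hreg hk)
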